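/- arXiv:1909.02546 — 2 statements merged into one kernel-verified Lean document; each statement's English description precedes it below -/
import Mathlib

section
/- Let r > 0, let W₁, W₂ be independent standard Brownian motions, and let X_i(t) = e^{−rt} W_i( (e^{2rt} − 1)/(2r) ) for i = 1, 2 be independent Ornstein–Uhlenbeck processes with mean-reversion rate r started at 0. For T > 0 define X̄_i = T^{−1} ∫_0^T X_i(u) du, Y_ij(T) = ∫_0^T X_i(u) X_j(u) du − T X̄_i X̄_j, and ρ(T) = Y₁₂(T) / √( Y₁₁(T) Y₂₂(T) ). Then ρ(T) → 0 almost surely as T → ∞. -/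
open MeasureTheory ProbabilityTheory Filter

/-- `W` is a standard Brownian motion under `P`: it is measurable in `ω` for each time,
has continuous paths on `[0,∞)`, starts at `0`, and every finite linear combination
`∑ i, c i * W (t i)` with times `t i ≥ 0` is a centered Gaussian with variance
`∑ i, ∑ j, c i * c j * min (t i) (t j)` (i.e. `W` is a centered Gaussian process with
covariance `Cov(W s, W t) = min s t`). -/
def IsStdBM {Ω : Type*} [MeasurableSpace Ω] (P : Measure Ω) (W : ℝ → Ω → ℝ) : Prop :=
  (∀ t : ℝ, Measurable (W t)) ∧
  (∀ ω, ContinuousOn (fun t => W t ω) (Set.Ici 0)) ∧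
  (∀ ω, W 0 ω = 0) ∧
  ∀ (n : ℕ) (t : Fin n → ℝ) (c : Fin n → ℝ), (∀ i, 0 ≤ t i) →
    P.map (fun ω => ∑ i, c i * W (t i) ω) =
      gaussianReal 0 (∑ i, ∑ j, c i * c j * min (t i) (t j)).toNNReal

section GaussianMoments

theorem integral_pow_four_gaussianReal (v : NNReal) :
    ∫ x, x ^ 4 ∂gaussianReal 0 v = 3 * (v : ℝ) ^ 2 := by
  have h := iteratedDeriv_mgf_zero (X := id) (μ := gaussianReal 0 v)
    (by simp [integrableExpSet_id_gaussianReal]) 4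
  have e : ∀ t : ℝ, HasDerivAt (fun t : ℝ => Real.exp (v * t ^ 2 / 2))
      (Real.exp (v * t ^ 2 / 2) * (v * t)) t := fun t =>
    ((((hasDerivAt_pow 2 t).const_mul (v : ℝ)).div_const 2).congr_deriv
      (by push_cast; ring)).exp
  have d : ∀ (p : ℝ → ℝ) (p' t : ℝ), HasDerivAt p p' t →
      deriv (fun t : ℝ => p t * Real.exp (v * t ^ 2 / 2)) t =
        (p' + v * t * p t) * Real.exp (v * t ^ 2 / 2) := fun p p' t hp =>
    ((hp.fun_mul (e t)).congr_deriv (by ring)).deriv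
  have d1 : deriv (fun t : ℝ => Real.exp (v * t ^ 2 / 2)) =
      fun t => v * t * Real.exp (v * t ^ 2 / 2) := by
    funext t
    rw [(e t).deriv, mul_comm]
  have d2 : deriv (fun t : ℝ => v * t * Real.exp (v * t ^ 2 / 2)) =
      fun t => (v + v ^ 2 * t ^ 2) * Real.exp (v * t ^ 2 / 2) := by
    funext t
    rw [d _ _ t ((hasDerivAt_id' t).const_mul (v : ℝ))]
    ring
  have d3 : deriv (fun t : ℝ => (v + v ^ 2 * t ^ 2) * Real.exp (v * t ^ 2 / 2)) =
      fun t => (3 * v ^ 2 * t + v ^ 3 * t ^ 3) * Real.exp (v * t ^ 2 / 2) := by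
    funext t
    rw [d _ _ t (((hasDerivAt_pow 2 t).const_mul ((v : ℝ) ^ 2)).const_add (v : ℝ))]
    push_cast
    ring
  have d4 : deriv (fun t : ℝ => (3 * v ^ 2 * t + v ^ 3 * t ^ 3) * Real.exp (v * t ^ 2 / 2)) 0 =
      3 * (v : ℝ) ^ 2 := by
    rw [d _ _ 0 (((hasDerivAt_id' (0 : ℝ)).const_mul (3 * (v : ℝ) ^ 2)).fun_add
      ((hasDerivAt_pow 3 (0 : ℝ)).const_mul ((v : ℝ) ^ 3)))]
    simp
  rw [mgf_id_gaussianReal] at h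
  simp only [zero_mul, zero_add, iteratedDeriv_succ, iteratedDeriv_zero, d1, d2, d3, d4] at h
  simpa using h.symm

theorem integral_sq_gaussianReal (v : NNReal) :
    ∫ x, x ^ 2 ∂gaussianReal 0 v = (v : ℝ) := by
  have h := variance_fun_id_gaussianReal (μ := 0) (v := v)
  rwa [variance_of_integral_eq_zero aemeasurable_id' (integral_id_gaussianReal)] at h

end GaussianMoments

theorem ae_tendsto_zero_of_integral_le {Ω : Type*} [MeasurableSpace Ω] {P : Measure Ω}
    {f : ℕ → Ω → ℝ} {a : ℕ → ℝ} (hf : ∀ n, Integrable (f n) P) (h0 : ∀ n ω, 0 ≤ f n ω)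
    (hle : ∀ n, ∫ ω, f n ω ∂P ≤ a n) (ha : Summable a) :
    ∀ᵐ ω ∂P, Tendsto (fun n => f n ω) atTop (nhds 0) := by
  have ha0 : ∀ n, 0 ≤ a n := fun n => (integral_nonneg (h0 n)).trans (hle n)
  have hm : ∀ n, AEMeasurable (fun ω => ENNReal.ofReal (f n ω)) P :=
    fun n => (hf n).aemeasurable.ennreal_ofReal
  have hfin : ∫⁻ ω, ∑' n, ENNReal.ofReal (f n ω) ∂P ≠ ⊤ := by
    rw [lintegral_tsum hm]
    refine ne_top_of_le_ne_top (b := ∑' n, ENNReal.ofReal (a n)) ?_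
      (ENNReal.tsum_le_tsum fun n => ?_)
    · rw [← ENNReal.ofReal_tsum_of_nonneg ha0 ha]
      exact ENNReal.ofReal_ne_top
    · rw [← ofReal_integral_eq_lintegral_ofReal (hf n) (.of_forall (h0 n))]
      exact ENNReal.ofReal_le_ofReal (hle n)
  filter_upwards [ae_lt_top' (AEMeasurable.tsum hm) hfin] with ω hω
  have h := ENNReal.tendsto_atTop_zero_of_tsum_ne_top hω.ne
  have h2 := (ENNReal.tendsto_toReal (ENNReal.zero_ne_top)).comp h
  refine h2.congr fun n => ?_
  simp [ENNReal.toReal_ofReal (h0 n ω)]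

section SecondMoment

variable {Ω : Type*} [MeasurableSpace Ω] {P : Measure Ω}

theorem integral_abs_mul_le_of_sq_le {f g : Ω → ℝ} {C : ℝ} (hf : MemLp f 2 P) (hg : MemLp g 2 P)
    (hfC : ∫ ω, f ω ^ 2 ∂P ≤ C) (hgC : ∫ ω, g ω ^ 2 ∂P ≤ C) :
    ∫ ω, |f ω * g ω| ∂P ≤ C := by
  have i1 := hf.integrable_sq
  have i2 := hg.integrable_sq
  calc ∫ ω, |f ω * g ω| ∂P ≤ ∫ ω, (f ω ^ 2 + g ω ^ 2) / 2 ∂P := by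
        refine integral_mono (hf.integrable_mul hg).abs ((i1.add i2).div_const 2) fun ω => ?_
        simp only [abs_le]
        constructor <;> nlinarith [sq_nonneg (f ω + g ω), sq_nonneg (f ω - g ω)]
    _ ≤ C := by
        rw [integral_div, integral_add i1 i2]
        linarith

variable [IsProbabilityMeasure P]

theorem integrable_prod_mul_of_sq_le {Z : ℝ → Ω → ℝ} {C a b : ℝ}
    (hm : ∀ t, Measurable (Z t)) (hc : ∀ ω, Continuous fun t => Z t ω)
    (hL : ∀ t, a ≤ t → MemLp (Z t) 2 P) (hC : ∀ t, a ≤ t → ∫ ω, Z t ω ^ 2 ∂P ≤ C) :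
    Integrable (fun p : (ℝ × ℝ) × Ω => Z p.1.1 p.2 * Z p.1.2 p.2)
      (((volume.restrict (Set.Ioc a b)).prod (volume.restrict (Set.Ioc a b))).prod P) := by
  have hu : Measurable (Function.uncurry Z) :=
    measurable_uncurry_of_continuous_of_measurable hc hm
  have hF : Measurable (fun p : (ℝ × ℝ) × Ω => Z p.1.1 p.2 * Z p.1.2 p.2) := by
    refine Measurable.mul ?_ ?_
    · exact hu.comp (f := fun p : (ℝ × ℝ) × Ω => (p.1.1, p.2)) (by fun_prop)
    · exact hu.comp (f := fun p : (ℝ × ℝ) × Ω => (p.1.2, p.2)) (by fun_prop)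
  have hae : ∀ᵐ x ∂((volume.restrict (Set.Ioc a b)).prod (volume.restrict (Set.Ioc a b))),
      a ≤ x.1 ∧ a ≤ x.2 := by
    rw [Measure.prod_restrict]
    filter_upwards [ae_restrict_mem (measurableSet_Ioc.prod measurableSet_Ioc)] with x hx
    exact ⟨hx.1.1.le, hx.2.1.le⟩
  rw [integrable_prod_iff hF.aestronglyMeasurable]
  refine ⟨?_, ?_⟩
  · filter_upwards [hae] with x hx
    exact (hL _ hx.1).integrable_mul (hL _ hx.2)
  · refine Integrable.of_bound (C := C)
      hF.norm.aestronglyMeasurable.integral_prod_right' ?_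
    filter_upwards [hae] with x hx
    rw [Real.norm_of_nonneg (integral_nonneg fun _ => norm_nonneg _)]
    exact integral_abs_mul_le_of_sq_le (hL _ hx.1) (hL _ hx.2) (hC _ hx.1) (hC _ hx.2)

theorem integrable_sq_intervalIntegral {Z : ℝ → Ω → ℝ} {C a b : ℝ} (hab : a ≤ b)
    (hm : ∀ t, Measurable (Z t)) (hc : ∀ ω, Continuous fun t => Z t ω)
    (hL : ∀ t, a ≤ t → MemLp (Z t) 2 P) (hC : ∀ t, a ≤ t → ∫ ω, Z t ω ^ 2 ∂P ≤ C) :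
    Integrable (fun ω => (∫ u in a..b, Z u ω) ^ 2) P := by
  refine (integrable_prod_mul_of_sq_le (b := b) hm hc hL hC).integral_prod_right.congr
    (.of_forall fun ω => ?_)
  simp only [intervalIntegral.integral_of_le hab]
  rw [integral_prod_mul (fun u => Z u ω) (fun u => Z u ω), sq]

theorem integral_sq_intervalIntegral_le {Z : ℝ → Ω → ℝ} {C a b : ℝ} {g : ℝ → ℝ → ℝ} {D : ℝ}
    (hab : a ≤ b)
    (hm : ∀ t, Measurable (Z t)) (hc : ∀ ω, Continuous fun t => Z t ω)
    (hL : ∀ t, a ≤ t → MemLp (Z t) 2 P) (hC : ∀ t, a ≤ t → ∫ ω, Z t ω ^ 2 ∂P ≤ C)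
    (hg : Continuous (Function.uncurry g))
    (hcov : ∀ u v, a ≤ u → a ≤ v → ∫ ω, Z u ω * Z v ω ∂P ≤ g u v)
    (hD : ∀ u, ∫ v in Set.Ioc a b, g u v ≤ D) :
    ∫ ω, (∫ u in a..b, Z u ω) ^ 2 ∂P ≤ (b - a) * D := by
  have hI := integrable_prod_mul_of_sq_le (b := b) hm hc hL hC
  have hgi : Integrable (fun x : ℝ × ℝ => g x.1 x.2)
      ((volume.restrict (Set.Ioc a b)).prod (volume.restrict (Set.Ioc a b))) := by
    rw [Measure.prod_restrict]
    exact (hg.continuousOn.integrableOn_compact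
      (isCompact_Icc.prod isCompact_Icc)).mono_set
        (Set.prod_mono Set.Ioc_subset_Icc_self Set.Ioc_subset_Icc_self)
  calc ∫ ω, (∫ u in a..b, Z u ω) ^ 2 ∂P
      = ∫ ω, ∫ x, Z x.1 ω * Z x.2 ω
          ∂((volume.restrict (Set.Ioc a b)).prod (volume.restrict (Set.Ioc a b))) ∂P := by
        refine integral_congr_ae (.of_forall fun ω => ?_)
        simp only [intervalIntegral.integral_of_le hab]
        rw [integral_prod_mul (fun u => Z u ω) (fun u => Z u ω), sq]
    _ = ∫ x, ∫ ω, Z x.1 ω * Z x.2 ω ∂P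
          ∂((volume.restrict (Set.Ioc a b)).prod (volume.restrict (Set.Ioc a b))) :=
        (integral_integral_swap (f := fun (x : ℝ × ℝ) ω => Z x.1 ω * Z x.2 ω) hI).symm
    _ ≤ ∫ x, g x.1 x.2
          ∂((volume.restrict (Set.Ioc a b)).prod (volume.restrict (Set.Ioc a b))) := by
        refine integral_mono_ae hI.integral_prod_left hgi ?_
        rw [Measure.prod_restrict]
        filter_upwards [ae_restrict_mem (measurableSet_Ioc.prod measurableSet_Ioc)] with x hx
        exact hcov _ _ hx.1.1.le hx.2.1.le
    _ = ∫ u in Set.Ioc a b, ∫ v in Set.Ioc a b, g u v := integral_prod _ hgi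
    _ ≤ ∫ _ in Set.Ioc a b, D :=
        integral_mono hgi.integral_prod_left (integrable_const D) hD
    _ = (b - a) * D := by simp [hab]

theorem integrable_exp_neg_mul_abs {r : ℝ} (hr : 0 < r) :
    Integrable fun x : ℝ => Real.exp (-r * |x|) := by
  rw [← integrableOn_univ, ← Set.Iic_union_Ioi (a := (0 : ℝ))]
  refine IntegrableOn.union ?_ ?_
  · refine (integrableOn_exp_mul_Iic hr 0).congr_fun (fun x hx => ?_) measurableSet_Iic
    simp only [abs_of_nonpos (Set.mem_Iic.1 hx)]
    ring_nf
  · refine (integrableOn_exp_mul_Ioi (neg_lt_zero.2 hr) 0).congr_fun (fun x hx => ?_)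
      measurableSet_Ioi
    simp only [abs_of_pos (Set.mem_Ioi.1 hx)]

theorem tendsto_abs_zero_of_tendsto_sq_zero {ι : Type*} {l : Filter ι} {f : ι → ℝ}
    (h : Tendsto (fun i => f i ^ 2) l (nhds 0)) : Tendsto (fun i => |f i|) l (nhds 0) := by
  simpa [Real.sqrt_sq_eq_abs] using h.sqrt

/-- Bound for a time average over `[0, T]` by the ones over the squares of integers around `T`. -/
theorem abs_inv_mul_integral_le {z : ℝ → ℝ} (hz : Continuous z) {T : ℝ} {n : ℕ} (hn : 0 < n)
    (h1 : (n : ℝ) ^ 2 ≤ T) (h2 : T ≤ ((n : ℝ) + 1) ^ 2) :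
    |T⁻¹ * ∫ u in (0 : ℝ)..T, z u| ≤ |((n : ℝ) ^ 2)⁻¹ * ∫ u in (0 : ℝ)..(n : ℝ) ^ 2, z u| +
      |((n : ℝ) ^ 2)⁻¹ * ∫ u in (n : ℝ) ^ 2..((n : ℝ) + 1) ^ 2, (|z u|)| := by
  have hn' : (0 : ℝ) < (n : ℝ) ^ 2 := by positivity
  have hi : ∀ a b : ℝ, IntervalIntegrable z volume a b := hz.intervalIntegrable
  have hi' : ∀ a b : ℝ, IntervalIntegrable (fun u => |z u|) volume a b :=
    hz.abs.intervalIntegrable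
  have hT : T⁻¹ ≤ ((n : ℝ) ^ 2)⁻¹ := inv_anti₀ hn' h1
  have hT0 : 0 ≤ T⁻¹ := inv_nonneg.2 (hn'.le.trans h1)
  have hb : |∫ u in (n : ℝ) ^ 2..T, z u| ≤ ∫ u in (n : ℝ) ^ 2..((n : ℝ) + 1) ^ 2, |z u| := by
    refine (intervalIntegral.abs_integral_le_integral_abs h1).trans ?_
    exact intervalIntegral.integral_mono_interval le_rfl h1 h2
      (.of_forall fun _ => abs_nonneg _) (hi' _ _)
  rw [← intervalIntegral.integral_add_adjacent_intervals (hi 0 ((n : ℝ) ^ 2)) (hi _ T),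
    abs_mul, abs_mul, abs_mul, abs_of_nonneg hT0, abs_of_pos (inv_pos.2 hn'), ← mul_add]
  refine mul_le_mul hT ((abs_add_le _ _).trans ?_) (abs_nonneg _) (inv_pos.2 hn').le
  exact add_le_add_right (hb.trans (le_abs_self _)) _

theorem ae_tendsto_average_zero {Z : ℝ → Ω → ℝ} {C r : ℝ} (hr : 0 < r)
    (hm : ∀ t, Measurable (Z t)) (hc : ∀ ω, Continuous fun t => Z t ω)
    (hL : ∀ t, 0 ≤ t → MemLp (Z t) 2 P)
    (hcov : ∀ u v, 0 ≤ u → 0 ≤ v → ∫ ω, Z u ω * Z v ω ∂P ≤ C * Real.exp (-r * |u - v|)) :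
    ∀ᵐ ω ∂P, Tendsto (fun T : ℝ => T⁻¹ * ∫ u in (0 : ℝ)..T, Z u ω) atTop (nhds 0) := by
  have hC : ∀ t, 0 ≤ t → ∫ ω, Z t ω ^ 2 ∂P ≤ C := fun t ht => by
    simpa [sq] using hcov t t ht ht
  have hC0 : 0 ≤ C := (integral_nonneg fun _ => sq_nonneg _).trans (hC 0 le_rfl)
  have hexp := integrable_exp_neg_mul_abs hr
  have hD : ∀ a b u : ℝ, ∫ v in Set.Ioc a b, C * Real.exp (-r * |u - v|) ≤
      C * ∫ x : ℝ, Real.exp (-r * |x|) := fun a b u => by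
    rw [integral_const_mul]
    refine mul_le_mul_of_nonneg_left ?_ hC0
    refine (setIntegral_le_integral (hexp.comp_sub_left u)
      (.of_forall fun _ => (Real.exp_pos _).le)).trans_eq ?_
    exact integral_sub_left_eq_self (fun x : ℝ => Real.exp (-r * |x|)) volume u
  set D := C * ∫ x : ℝ, Real.exp (-r * |x|)
  have hsum : Summable fun n : ℕ => ((n : ℝ) ^ 2)⁻¹ :=
    Real.summable_nat_pow_inv.2 one_lt_two
  have hA : ∀ᵐ ω ∂P, Tendsto (fun n : ℕ =>
      (((n : ℝ) ^ 2)⁻¹ * ∫ u in (0 : ℝ)..(n : ℝ) ^ 2, Z u ω) ^ 2) atTop (nhds 0) := by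
    refine ae_tendsto_zero_of_integral_le (fun n => ?_) (fun _ _ => sq_nonneg _) (fun n => ?_)
      (hsum.mul_left D)
    · simp only [mul_pow]
      exact (integrable_sq_intervalIntegral (by positivity) hm hc hL hC).const_mul _
    · simp only [mul_pow]
      rw [integral_const_mul]
      have h := integral_sq_intervalIntegral_le (b := (n : ℝ) ^ 2) (by positivity) hm hc hL hC
        (g := fun u v => C * Real.exp (-r * |u - v|)) (by fun_prop) hcov (hD _ _)
      refine (mul_le_mul_of_nonneg_left h (sq_nonneg _)).trans_eq ?_
      rcases eq_or_ne n 0 with rfl | hn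
      · simp
      · field_simp
        ring
  have hB : ∀ᵐ ω ∂P, Tendsto (fun n : ℕ =>
      (((n : ℝ) ^ 2)⁻¹ * ∫ u in (n : ℝ) ^ 2..((n : ℝ) + 1) ^ 2, |Z u ω|) ^ 2) atTop (nhds 0) := by
    have hle : ∀ n : ℕ, (n : ℝ) ^ 2 ≤ ((n : ℝ) + 1) ^ 2 := fun n => by
      gcongr
      linarith
    have h0 : ∀ (n : ℕ) (t : ℝ), (n : ℝ) ^ 2 ≤ t → 0 ≤ t := fun n t => (sq_nonneg _).trans
    have hm' : ∀ t, Measurable fun ω => |Z t ω| := fun t => (hm t).abs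
    have hc' : ∀ ω, Continuous fun t => |Z t ω| := fun ω => (hc ω).abs
    have hL' : ∀ (n : ℕ) (t : ℝ), (n : ℝ) ^ 2 ≤ t → MemLp (fun ω => |Z t ω|) 2 P :=
      fun n t ht => (hL t (h0 n t ht)).abs
    have hC' : ∀ (n : ℕ) (t : ℝ), (n : ℝ) ^ 2 ≤ t → ∫ ω, |Z t ω| ^ 2 ∂P ≤ C := fun n t ht => by
      simpa using hC t (h0 n t ht)
    refine ae_tendsto_zero_of_integral_le (fun n => ?_) (fun _ _ => sq_nonneg _) (fun n => ?_)
      (hsum.mul_left (9 * C))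
    · simp only [mul_pow]
      exact (integrable_sq_intervalIntegral (hle n) hm' hc' (hL' n) (hC' n)).const_mul _
    · simp only [mul_pow]
      rw [integral_const_mul]
      have h := integral_sq_intervalIntegral_le (hle n) hm' hc' (hL' n) (hC' n)
        (g := fun _ _ => C) (D := (((n : ℝ) + 1) ^ 2 - (n : ℝ) ^ 2) * C) (by fun_prop)
        (fun u v hu hv => by
          simpa only [abs_mul] using integral_abs_mul_le_of_sq_le (hL u (h0 n u hu))
            (hL v (h0 n v hv)) (hC u (h0 n u hu)) (hC v (h0 n v hv)))
        (fun u => by simp [hle n])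
      refine (mul_le_mul_of_nonneg_left h (sq_nonneg _)).trans ?_
      rcases Nat.eq_zero_or_pos n with rfl | hn
      · simp
      · have hn1 : (1 : ℝ) ≤ n := by exact_mod_cast hn
        have key : (((n : ℝ) + 1) ^ 2 - (n : ℝ) ^ 2) ^ 2 ≤ 9 * (n : ℝ) ^ 2 := by nlinarith
        calc _ = (((n : ℝ) ^ 2)⁻¹) ^ 2 * ((((n : ℝ) + 1) ^ 2 - (n : ℝ) ^ 2) ^ 2 * C) := by ring
          _ ≤ (((n : ℝ) ^ 2)⁻¹) ^ 2 * (9 * (n : ℝ) ^ 2 * C) := by gcongr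
          _ = 9 * C * ((n : ℝ) ^ 2)⁻¹ := by field_simp
  filter_upwards [hA, hB] with ω hAω hBω
  have hsqrt : Tendsto Nat.sqrt atTop atTop := tendsto_atTop.2 fun b => by
    filter_upwards [eventually_ge_atTop (b * b)] with m hm
    exact Nat.le_sqrt.2 hm
  have hlim : Tendsto (fun T : ℝ => Nat.sqrt ⌊T⌋₊) atTop atTop :=
    hsqrt.comp tendsto_nat_floor_atTop
  have hsq := ((tendsto_abs_zero_of_tendsto_sq_zero hAω).add
    (tendsto_abs_zero_of_tendsto_sq_zero hBω)).comp hlim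
  rw [add_zero] at hsq
  refine squeeze_zero_norm' ?_ hsq
  filter_upwards [eventually_ge_atTop (1 : ℝ)] with T hT
  have hT0 : 0 ≤ T := zero_le_one.trans hT
  refine abs_inv_mul_integral_le (hc ω) (Nat.sqrt_pos.2 (Nat.floor_pos.2 hT)) ?_ ?_
  · calc ((Nat.sqrt ⌊T⌋₊ : ℕ) : ℝ) ^ 2 ≤ (⌊T⌋₊ : ℝ) := by exact_mod_cast Nat.sqrt_le' _
      _ ≤ T := Nat.floor_le hT0
  · refine (Nat.lt_floor_add_one T).le.trans ?_
    exact_mod_cast Nat.succ_le_succ_sqrt' ⌊T⌋₊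

end SecondMoment

section GaussianPair

variable {Ω : Type*} [MeasurableSpace Ω] {P : Measure Ω} {f g : Ω → ℝ} {v : NNReal}

theorem memLp_two_of_map_eq_gaussianReal (hf : Measurable f) (h : P.map f = gaussianReal 0 v) :
    MemLp f 2 P :=
  MemLp.comp_of_map (g := id) (h ▸ memLp_id_gaussianReal 2) hf.aemeasurable

theorem memLp_two_sq_of_map_eq_gaussianReal (hf : Measurable f)
    (h : P.map f = gaussianReal 0 v) : MemLp (fun ω => f ω ^ 2) 2 P := by
  rw [memLp_two_iff_integrable_sq (by fun_prop)]
  have h4 : MemLp f (4 : ℕ) P :=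
    MemLp.comp_of_map (g := id) (h ▸ memLp_id_gaussianReal 4) hf.aemeasurable
  refine (h4.integrable_norm_pow four_ne_zero).congr (.of_forall fun ω => ?_)
  simp only [Real.norm_eq_abs]
  rw [← pow_mul, Even.pow_abs (by decide)]

theorem integral_sq_of_map_eq_gaussianReal (hf : Measurable f) (h : P.map f = gaussianReal 0 v) :
    ∫ ω, f ω ^ 2 ∂P = v := by
  rw [← integral_sq_gaussianReal v, ← h, integral_map hf.aemeasurable (by fun_prop)]

theorem integral_pow_four_of_map_eq_gaussianReal (hf : Measurable f)
    (h : P.map f = gaussianReal 0 v) : ∫ ω, f ω ^ 4 ∂P = 3 * (v : ℝ) ^ 2 := by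
  rw [← integral_pow_four_gaussianReal v, ← h, integral_map hf.aemeasurable (by fun_prop)]

/-- `(f, g)` is a centered Gaussian vector with covariance matrix `[[A, K], [K, B]]`. -/
def IsGaussianPair (P : Measure Ω) (f g : Ω → ℝ) (A K B : ℝ) : Prop :=
  ∀ a b : ℝ, ∃ v : NNReal, (v : ℝ) = a ^ 2 * A + 2 * a * b * K + b ^ 2 * B ∧
    P.map (fun ω => a * f ω + b * g ω) = gaussianReal 0 v

namespace IsGaussianPair

variable {A K B : ℝ}

theorem map_left (h : IsGaussianPair P f g A K B) :
    ∃ v : NNReal, (v : ℝ) = A ∧ P.map f = gaussianReal 0 v := by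
  simpa using h 1 0

theorem map_right (h : IsGaussianPair P f g A K B) :
    ∃ v : NNReal, (v : ℝ) = B ∧ P.map g = gaussianReal 0 v := by
  simpa using h 0 1

theorem integral_mul (h : IsGaussianPair P f g A K B) (hf : Measurable f) (hg : Measurable g) :
    ∫ ω, f ω * g ω ∂P = K := by
  obtain ⟨v₁, e₁, h₁⟩ := h.map_left
  obtain ⟨v₂, e₂, h₂⟩ := h.map_right
  obtain ⟨v, e, hv⟩ := h 1 1
  have i₁ := memLp_two_of_map_eq_gaussianReal hf h₁
  have i₂ := memLp_two_of_map_eq_gaussianReal hg h₂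
  have s₁ := integral_sq_of_map_eq_gaussianReal hf h₁
  have s₂ := integral_sq_of_map_eq_gaussianReal hg h₂
  have s := integral_sq_of_map_eq_gaussianReal (by fun_prop) hv
  have hfg : Integrable (fun ω => f ω * g ω) P := i₁.integrable_mul i₂
  have hexp : ∀ ω, (1 * f ω + 1 * g ω) ^ 2 = f ω ^ 2 + 2 * (f ω * g ω) + g ω ^ 2 :=
    fun ω => by ring
  simp only [hexp] at s
  rw [integral_add (i₁.integrable_sq.fun_add (hfg.const_mul 2)) i₂.integrable_sq,
    integral_add i₁.integrable_sq (hfg.const_mul 2), integral_const_mul, s₁, s₂] at s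
  linarith

theorem integral_sq_mul_sq (h : IsGaussianPair P f g A K B) (hf : Measurable f)
    (hg : Measurable g) : ∫ ω, f ω ^ 2 * g ω ^ 2 ∂P = A * B + 2 * K ^ 2 := by
  obtain ⟨v₁, e₁, h₁⟩ := h.map_left
  obtain ⟨v₂, e₂, h₂⟩ := h.map_right
  obtain ⟨v, e, hv⟩ := h 1 1
  obtain ⟨w, e', hw⟩ := h 1 (-1)
  have i₁ := memLp_two_sq_of_map_eq_gaussianReal hf h₁
  have i₂ := memLp_two_sq_of_map_eq_gaussianReal hg h₂
  have iv := (memLp_two_sq_of_map_eq_gaussianReal (by fun_prop) hv).integrable_sq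
  have iw := (memLp_two_sq_of_map_eq_gaussianReal (by fun_prop) hw).integrable_sq
  have s₁ := integral_pow_four_of_map_eq_gaussianReal hf h₁
  have s₂ := integral_pow_four_of_map_eq_gaussianReal hg h₂
  have sv := integral_pow_four_of_map_eq_gaussianReal (by fun_prop) hv
  have sw := integral_pow_four_of_map_eq_gaussianReal (by fun_prop) hw
  have j₁ := i₁.integrable_sq
  have j₂ := i₂.integrable_sq
  simp only [← pow_mul, Nat.reduceMul] at iv iw j₁ j₂
  have hexp : ∀ ω, f ω ^ 2 * g ω ^ 2 = 12⁻¹ * ((1 * f ω + 1 * g ω) ^ 4 +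
      (1 * f ω + -1 * g ω) ^ 4 - 2 * f ω ^ 4 - 2 * g ω ^ 4) := fun ω => by ring
  have hsub : Integrable (fun ω => (1 * f ω + 1 * g ω) ^ 4 + (1 * f ω + -1 * g ω) ^ 4 -
      2 * f ω ^ 4) P := (iv.add iw).sub (j₁.const_mul 2)
  simp only [hexp]
  rw [integral_const_mul, integral_sub hsub (j₂.const_mul 2),
    integral_sub (iv.fun_add iw) (j₁.const_mul 2), integral_add iv iw, integral_const_mul,
    integral_const_mul, s₁, s₂, sv, sw, e, e', e₁, e₂]
  ring

end IsGaussianPair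

end GaussianPair

section OrnsteinUhlenbeck

/-- The covariance at times `u, v` of the Ornstein–Uhlenbeck process with rate `r` started
at `0`. -/
noncomputable def ouCov (r u v : ℝ) : ℝ :=
  (Real.exp (-r * |u - v|) - Real.exp (-r * (u + v))) / (2 * r)

variable {r : ℝ}

theorem ouCov_nonneg (hr : 0 < r) {u v : ℝ} (hu : 0 ≤ u) (hv : 0 ≤ v) : 0 ≤ ouCov r u v := by
  refine div_nonneg (sub_nonneg.2 (Real.exp_le_exp.2 ?_)) (by positivity)
  have : |u - v| ≤ u + v := abs_le.2 ⟨by linarith, by linarith⟩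
  nlinarith

theorem ouCov_le (hr : 0 < r) (u v : ℝ) :
    ouCov r u v ≤ 1 / (2 * r) * Real.exp (-r * |u - v|) := by
  rw [ouCov, one_div_mul_eq_div]
  gcongr
  linarith [Real.exp_pos (-r * (u + v))]

theorem ouCov_sq_le (hr : 0 < r) {u v : ℝ} (hu : 0 ≤ u) (hv : 0 ≤ v) :
    ouCov r u v ^ 2 ≤ (1 / (2 * r)) ^ 2 * Real.exp (-r * |u - v|) := by
  have h1 : Real.exp (-r * |u - v|) ≤ 1 :=
    Real.exp_le_one_iff.2 (by nlinarith [abs_nonneg (u - v)])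
  calc ouCov r u v ^ 2 ≤ (1 / (2 * r) * Real.exp (-r * |u - v|)) ^ 2 :=
        pow_le_pow_left₀ (ouCov_nonneg hr hu hv) (ouCov_le hr u v) 2
    _ = (1 / (2 * r)) ^ 2 * Real.exp (-r * |u - v|) ^ 2 := mul_pow _ _ _
    _ ≤ (1 / (2 * r)) ^ 2 * Real.exp (-r * |u - v|) := by
        gcongr
        exact pow_le_of_le_one (Real.exp_pos _).le h1 two_ne_zero

theorem ouCov_self_sub_mul_le (hr : 0 < r) {u v : ℝ} (hu : 0 ≤ u) (hv : 0 ≤ v) :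
    (ouCov r u u - 1 / (2 * r)) * (ouCov r v v - 1 / (2 * r)) ≤
      (1 / (2 * r)) ^ 2 * Real.exp (-r * |u - v|) := by
  have h : ∀ t, ouCov r t t - 1 / (2 * r) = -(1 / (2 * r)) * Real.exp (-r * (t + t)) := fun t => by
    simp only [ouCov, sub_self, abs_zero, mul_zero, Real.exp_zero]
    ring
  have habs : |u - v| ≤ u + v := abs_le.2 ⟨by linarith, by linarith⟩
  calc _ = (1 / (2 * r)) ^ 2 * Real.exp (-r * (u + u) + -r * (v + v)) := by
        rw [h, h, Real.exp_add]
        ring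
    _ ≤ _ := by
        gcongr
        nlinarith

theorem exp_mul_exp_mul_min_eq_ouCov (hr : 0 < r) (u v : ℝ) :
    Real.exp (-r * u) * Real.exp (-r * v) *
      min ((Real.exp (2 * r * u) - 1) / (2 * r)) ((Real.exp (2 * r * v) - 1) / (2 * r)) =
        ouCov r u v := by
  wlog huv : u ≤ v generalizing u v
  · rw [mul_comm (Real.exp _), min_comm, this v u (le_of_not_ge huv), ouCov, ouCov, abs_sub_comm,
      add_comm]
  have hmin : (Real.exp (2 * r * u) - 1) / (2 * r) ≤ (Real.exp (2 * r * v) - 1) / (2 * r) := by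
    gcongr
  have h1 : -r * |u - v| = -r * u + -r * v + 2 * r * u := by
    rw [abs_of_nonpos (by linarith)]
    ring
  rw [min_eq_left hmin, ouCov, h1, mul_add, Real.exp_add, Real.exp_add]
  ring

theorem ouTime_nonneg (hr : 0 < r) {t : ℝ} (ht : 0 ≤ t) :
    0 ≤ (Real.exp (2 * r * t) - 1) / (2 * r) :=
  div_nonneg (sub_nonneg.2 (Real.one_le_exp (by positivity))) (by positivity)

theorem add_two_mul_min_add_nonneg {s t : ℝ} (hs : 0 ≤ s) (ht : 0 ≤ t) (a b : ℝ) :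
    0 ≤ a ^ 2 * s + 2 * a * b * min s t + b ^ 2 * t := by
  rcases le_total s t with h | h
  · rw [min_eq_left h]
    nlinarith [mul_nonneg (sq_nonneg (a + b)) hs, mul_nonneg (sq_nonneg b) (sub_nonneg.2 h)]
  · rw [min_eq_right h]
    nlinarith [mul_nonneg (sq_nonneg (a + b)) ht, mul_nonneg (sq_nonneg a) (sub_nonneg.2 h)]

variable {Ω : Type*} [MeasurableSpace Ω] {P : Measure Ω} {W X : ℝ → Ω → ℝ}

theorem IsStdBM.isGaussianPair (hW : IsStdBM P W) {s t : ℝ} (hs : 0 ≤ s) (ht : 0 ≤ t) :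
    IsGaussianPair P (W s) (W t) s (min s t) t := by
  intro a b
  refine ⟨_, Real.coe_toNNReal _ (add_two_mul_min_add_nonneg hs ht a b), ?_⟩
  have h := hW.2.2.2 2 ![s, t] ![a, b] (by simp [Fin.forall_fin_two, hs, ht])
  simp only [Fin.sum_univ_two, Matrix.cons_val_zero, Matrix.cons_val_one, min_self] at h
  rw [h, min_comm t s]
  congr 2
  ring

theorem isGaussianPair_ou (hr : 0 < r) (hW : IsStdBM P W)
    (hX : ∀ t ω, X t ω = Real.exp (-r * t) * W ((Real.exp (2 * r * t) - 1) / (2 * r)) ω)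
    {u v : ℝ} (hu : 0 ≤ u) (hv : 0 ≤ v) :
    IsGaussianPair P (X u) (X v) (ouCov r u u) (ouCov r u v) (ouCov r v v) := by
  intro a b
  obtain ⟨w, hw, hlaw⟩ := hW.isGaussianPair (ouTime_nonneg hr hu) (ouTime_nonneg hr hv)
    (a * Real.exp (-r * u)) (b * Real.exp (-r * v))
  refine ⟨w, ?_, ?_⟩
  · simp only [← exp_mul_exp_mul_min_eq_ouCov hr, min_self]
    rw [hw]
    ring
  · simp only [hX, ← hlaw, mul_assoc]

theorem measurable_ou (hW : IsStdBM P W)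
    (hX : ∀ t ω, X t ω = Real.exp (-r * t) * W ((Real.exp (2 * r * t) - 1) / (2 * r)) ω) (t : ℝ) :
    Measurable (X t) := by
  rw [funext (hX t)]
  exact (hW.1 _).const_mul _

theorem continuous_ou_abs (hr : 0 < r) (hW : IsStdBM P W)
    (hX : ∀ t ω, X t ω = Real.exp (-r * t) * W ((Real.exp (2 * r * t) - 1) / (2 * r)) ω) (ω : Ω) :
    Continuous fun t => X |t| ω := by
  simp only [hX]
  refine Continuous.mul (by fun_prop) ?_
  exact (hW.2.1 ω).comp_continuous (f := fun t : ℝ => (Real.exp (2 * r * |t|) - 1) / (2 * r))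
    (by fun_prop) fun t => ouTime_nonneg hr (abs_nonneg t)

/-- Extending a process evenly to negative times does not change its averages over `[0, T]`. -/
theorem tendsto_average_of_comp_abs {z : ℝ → ℝ} {c : ℝ}
    (h : Tendsto (fun T : ℝ => T⁻¹ * ∫ u in (0 : ℝ)..T, z |u|) atTop (nhds c)) :
    Tendsto (fun T : ℝ => T⁻¹ * ∫ u in (0 : ℝ)..T, z u) atTop (nhds c) := by
  refine h.congr' ?_
  filter_upwards [eventually_ge_atTop 0] with T hT
  congr 1
  refine intervalIntegral.integral_congr fun u hu => ?_
  rw [Set.uIcc_of_le hT] at hu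
  simp only [abs_of_nonneg hu.1]

variable [IsProbabilityMeasure P]

theorem ae_tendsto_average_ou (hr : 0 < r) (hW : IsStdBM P W)
    (hX : ∀ t ω, X t ω = Real.exp (-r * t) * W ((Real.exp (2 * r * t) - 1) / (2 * r)) ω) :
    ∀ᵐ ω ∂P, Tendsto (fun T : ℝ => T⁻¹ * ∫ u in (0 : ℝ)..T, X u ω) atTop (nhds 0) := by
  have hm := measurable_ou hW hX
  have h := ae_tendsto_average_zero (P := P) (Z := fun t ω => X |t| ω) (C := 1 / (2 * r)) hr
    (fun t => hm _) (continuous_ou_abs hr hW hX) (fun t ht => ?_) (fun u v hu hv => ?_)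
  · filter_upwards [h] with ω hω using tendsto_average_of_comp_abs hω
  · obtain ⟨_, _, hlaw⟩ := (isGaussianPair_ou hr hW hX (abs_nonneg t) (abs_nonneg t)).map_left
    exact memLp_two_of_map_eq_gaussianReal (hm _) hlaw
  · simp only [abs_of_nonneg hu, abs_of_nonneg hv]
    rw [(isGaussianPair_ou hr hW hX hu hv).integral_mul (hm u) (hm v)]
    exact ouCov_le hr u v

theorem ae_tendsto_average_ou_sq (hr : 0 < r) (hW : IsStdBM P W)
    (hX : ∀ t ω, X t ω = Real.exp (-r * t) * W ((Real.exp (2 * r * t) - 1) / (2 * r)) ω) :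
    ∀ᵐ ω ∂P, Tendsto (fun T : ℝ => T⁻¹ * ∫ u in (0 : ℝ)..T, X u ω * X u ω) atTop
      (nhds (1 / (2 * r))) := by
  have hm := measurable_ou hW hX
  have hc := continuous_ou_abs hr hW hX
  have hL : ∀ t, 0 ≤ t → MemLp (fun ω => X t ω ^ 2) 2 P := fun t ht => by
    obtain ⟨_, _, hlaw⟩ := (isGaussianPair_ou hr hW hX ht ht).map_left
    exact memLp_two_sq_of_map_eq_gaussianReal (hm _) hlaw
  have hv : ∀ t, 0 ≤ t → ∫ ω, X t ω ^ 2 ∂P = ouCov r t t := fun t ht => by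
    simp only [sq]
    exact (isGaussianPair_ou hr hW hX ht ht).integral_mul (hm t) (hm t)
  have h := ae_tendsto_average_zero (P := P) (Z := fun t ω => X |t| ω ^ 2 - 1 / (2 * r))
    (C := 3 * (1 / (2 * r)) ^ 2) hr (fun t => ((hm _).pow_const 2).sub_const _)
    (fun ω => ((hc ω).pow 2).sub continuous_const)
    (fun t ht => (hL _ (abs_nonneg t)).sub (memLp_const _)) (fun u v hu hv' => ?_)
  · filter_upwards [h] with ω hω
    refine tendsto_average_of_comp_abs (z := fun u => X u ω * X u ω) ?_
    have h2 := hω.add_const (1 / (2 * r))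
    rw [zero_add] at h2
    refine h2.congr' ?_
    filter_upwards [eventually_gt_atTop 0] with T hT
    have hc2 : Continuous fun t => X |t| ω ^ 2 := (hc ω).pow 2
    rw [intervalIntegral.integral_sub (hc2.intervalIntegrable _ _)
      intervalIntegrable_const, intervalIntegral.integral_const]
    simp only [sq, sub_zero, smul_eq_mul]
    field_simp
    ring
  · have hu2 : Integrable (fun ω => X u ω ^ 2) P := (hL u hu).integrable one_le_two
    have hv2 : Integrable (fun ω => X v ω ^ 2) P := (hL v hv').integrable one_le_two
    have huv : Integrable (fun ω => X u ω ^ 2 * X v ω ^ 2) P := (hL u hu).integrable_mul (hL v hv')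
    have hexp : ∀ ω, (X u ω ^ 2 - 1 / (2 * r)) * (X v ω ^ 2 - 1 / (2 * r)) =
        X u ω ^ 2 * X v ω ^ 2 - 1 / (2 * r) * X u ω ^ 2 - 1 / (2 * r) * X v ω ^ 2 +
          (1 / (2 * r)) ^ 2 := fun ω => by ring
    have hsub₁ : Integrable (fun ω => X u ω ^ 2 * X v ω ^ 2 - 1 / (2 * r) * X u ω ^ 2) P :=
      huv.sub (hu2.const_mul _)
    have hsub₂ : Integrable (fun ω => X u ω ^ 2 * X v ω ^ 2 - 1 / (2 * r) * X u ω ^ 2 -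
        1 / (2 * r) * X v ω ^ 2) P := hsub₁.sub (hv2.const_mul _)
    simp only [abs_of_nonneg hu, abs_of_nonneg hv', hexp]
    rw [integral_add hsub₂ (integrable_const _),
      integral_sub hsub₁ (hv2.const_mul _),
      integral_sub huv (hu2.const_mul _), integral_const_mul, integral_const_mul, hv u hu,
      hv v hv', (isGaussianPair_ou hr hW hX hu hv').integral_sq_mul_sq (hm u) (hm v)]
    simp only [integral_const, probReal_univ, one_smul]
    linarith [ouCov_sq_le hr hu hv', ouCov_self_sub_mul_le hr hu hv']

theorem ae_tendsto_average_ou_mul {W' X' : ℝ → Ω → ℝ} (hr : 0 < r) (hW : IsStdBM P W)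
    (hW' : IsStdBM P W') (hindep : IndepFun (fun ω t => W t ω) (fun ω t => W' t ω) P)
    (hX : ∀ t ω, X t ω = Real.exp (-r * t) * W ((Real.exp (2 * r * t) - 1) / (2 * r)) ω)
    (hX' : ∀ t ω, X' t ω = Real.exp (-r * t) * W' ((Real.exp (2 * r * t) - 1) / (2 * r)) ω) :
    ∀ᵐ ω ∂P, Tendsto (fun T : ℝ => T⁻¹ * ∫ u in (0 : ℝ)..T, X u ω * X' u ω) atTop (nhds 0) := by
  have hm := measurable_ou hW hX
  have hm' := measurable_ou hW' hX'
  have hind : ∀ u v, IndepFun (fun ω => X u ω * X v ω) (fun ω => X' u ω * X' v ω) P := by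
    intro u v
    have hφ : Measurable fun w : ℝ → ℝ =>
        (Real.exp (-r * u) * w ((Real.exp (2 * r * u) - 1) / (2 * r))) *
          (Real.exp (-r * v) * w ((Real.exp (2 * r * v) - 1) / (2 * r))) := by fun_prop
    simp only [hX, hX']
    exact hindep.comp hφ hφ
  have h := ae_tendsto_average_zero (P := P) (Z := fun t ω => X |t| ω * X' |t| ω)
    (C := (1 / (2 * r)) ^ 2) hr (fun t => (hm _).mul (hm' _))
    (fun ω => (continuous_ou_abs hr hW hX ω).mul (continuous_ou_abs hr hW' hX' ω))
    (fun t ht => ?_) (fun u v hu hv => ?_)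
  · filter_upwards [h] with ω hω
    exact tendsto_average_of_comp_abs (z := fun u => X u ω * X' u ω) hω
  · refine (memLp_two_iff_integrable_sq ((hm _).mul (hm' _)).aestronglyMeasurable).2 ?_
    obtain ⟨_, _, hlaw⟩ := (isGaussianPair_ou hr hW hX (abs_nonneg t) (abs_nonneg t)).map_left
    obtain ⟨_, _, hlaw'⟩ := (isGaussianPair_ou hr hW' hX' (abs_nonneg t) (abs_nonneg t)).map_left
    have i := (memLp_two_of_map_eq_gaussianReal (hm _) hlaw).integrable_sq
    have i' := (memLp_two_of_map_eq_gaussianReal (hm' _) hlaw').integrable_sq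
    simp only [sq] at i i'
    refine ((hind |t| |t|).integrable_mul i i').congr (.of_forall fun ω => ?_)
    simp only [Pi.mul_apply]
    ring
  · simp only [abs_of_nonneg hu, abs_of_nonneg hv, mul_mul_mul_comm]
    rw [(hind u v).integral_fun_mul_eq_mul_integral
      ((hm u).mul (hm v)).aestronglyMeasurable ((hm' u).mul (hm' v)).aestronglyMeasurable,
      (isGaussianPair_ou hr hW hX hu hv).integral_mul (hm u) (hm v),
      (isGaussianPair_ou hr hW' hX' hu hv).integral_mul (hm' u) (hm' v), ← sq]
    exact ouCov_sq_le hr hu hv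

end OrnsteinUhlenbeck

theorem stmt_11 {Ω : Type*} [MeasurableSpace Ω] (P : Measure Ω) [IsProbabilityMeasure P]
    (r : ℝ) (hr : 0 < r) (W₁ W₂ : ℝ → Ω → ℝ) (hW₁ : IsStdBM P W₁) (hW₂ : IsStdBM P W₂)
    (hindep : IndepFun (fun ω => fun t => W₁ t ω) (fun ω => fun t => W₂ t ω) P)
    (X₁ X₂ : ℝ → Ω → ℝ)
    (hX₁ : ∀ t ω, X₁ t ω = Real.exp (-r * t) * W₁ ((Real.exp (2 * r * t) - 1) / (2 * r)) ω)
    (hX₂ : ∀ t ω, X₂ t ω = Real.exp (-r * t) * W₂ ((Real.exp (2 * r * t) - 1) / (2 * r)) ω)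
    (Xbar₁ Xbar₂ : ℝ → Ω → ℝ)
    (hXbar₁ : ∀ T ω, Xbar₁ T ω = T⁻¹ * ∫ u in (0:ℝ)..T, X₁ u ω)
    (hXbar₂ : ∀ T ω, Xbar₂ T ω = T⁻¹ * ∫ u in (0:ℝ)..T, X₂ u ω)
    (Y₁₁ Y₁₂ Y₂₂ : ℝ → Ω → ℝ)
    (hY₁₁ : ∀ T ω, Y₁₁ T ω = (∫ u in (0:ℝ)..T, X₁ u ω * X₁ u ω) - T * Xbar₁ T ω * Xbar₁ T ω)
    (hY₁₂ : ∀ T ω, Y₁₂ T ω = (∫ u in (0:ℝ)..T, X₁ u ω * X₂ u ω) - T * Xbar₁ T ω * Xbar₂ T ω)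
    (hY₂₂ : ∀ T ω, Y₂₂ T ω = (∫ u in (0:ℝ)..T, X₂ u ω * X₂ u ω) - T * Xbar₂ T ω * Xbar₂ T ω)
    (ρ : ℝ → Ω → ℝ)
    (hρ : ∀ T ω, ρ T ω = Y₁₂ T ω / Real.sqrt (Y₁₁ T ω * Y₂₂ T ω)) :
    ∀ᵐ ω ∂P, Tendsto (fun T => ρ T ω) atTop (nhds 0) := by
  filter_upwards [ae_tendsto_average_ou hr hW₁ hX₁, ae_tendsto_average_ou hr hW₂ hX₂,
    ae_tendsto_average_ou_sq hr hW₁ hX₁, ae_tendsto_average_ou_sq hr hW₂ hX₂,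
    ae_tendsto_average_ou_mul hr hW₁ hW₂ hindep hX₁ hX₂] with ω h₁ h₂ h₁₁ h₂₂ h₁₂
  have hY₁ := h₁₁.sub (h₁.mul h₁)
  have hY₂ := h₂₂.sub (h₂.mul h₂)
  have hY := h₁₂.sub (h₁.mul h₂)
  simp only [mul_zero, sub_zero] at hY₁ hY₂ hY
  have hq : Real.sqrt (1 / (2 * r) * (1 / (2 * r))) ≠ 0 :=
    (Real.sqrt_pos.2 (by positivity)).ne'
  have h := hY.div (hY₁.mul hY₂).sqrt hq
  rw [zero_div] at h
  refine h.congr' ?_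
  filter_upwards [eventually_gt_atTop 0] with T hT
  have key : ∀ m a b : ℝ, m - T * (T⁻¹ * a) * (T⁻¹ * b) =
      T * (T⁻¹ * m - (T⁻¹ * a) * (T⁻¹ * b)) := fun m a b => by
    field_simp
  rw [hρ, hY₁₁, hY₁₂, hY₂₂, hXbar₁, hXbar₂, key, key, key, mul_mul_mul_comm T,
    Real.sqrt_mul (by positivity), Real.sqrt_mul_self hT.le, mul_div_mul_left _ _ hT.ne',
    Pi.div_apply]
end

section
/- Let r > 0, let W₁, W₂ be independent standard Brownian motions, and let X_i(t) = e^{−rt} W_i( (e^{2rt} − 1)/(2r) ) for i = 1, 2 be independent Ornstein–Uhlenbeck processes with mean-reversion rate r started at 0. Then for every T > 0 and every θ ∈ ℝ, E[ exp( (iθ/√T) ∫_0^T X₁(s) X₂(s) ds ) ] = E[ exp( −(θ²/(2T)) ∫_0^T ( ∫_u^T e^{−r(s−u)} X₂(s) ds )² du ) ]. -/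
open MeasureTheory ProbabilityTheory Filter

section

open Topology Set

lemma natCeil_div_eq_of_mem_Ioc {h s : ℝ} (hh : 0 < h) {k : ℕ}
    (hs : s ∈ Ioc (h * k) (h * (k + 1))) : ⌈s / h⌉₊ = k + 1 := by
  rw [Nat.ceil_eq_iff (by simp)]
  refine ⟨?_, ?_⟩
  · rw [lt_div_iff₀ hh]
    simpa [mul_comm] using hs.1
  · rw [div_le_iff₀ hh]
    simpa [mul_comm] using hs.2

lemma mul_sum_eq_integral_comp_ceil (f : ℝ → ℝ) {h : ℝ} (hh : 0 < h) (n : ℕ) :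
    h * ∑ k ∈ Finset.range n, f (h * (k + 1)) = ∫ s in (0 : ℝ)..(h * n), f (h * ⌈s / h⌉₊) := by
  have hle (k : ℕ) : h * k ≤ h * (k + 1) := by nlinarith
  have hcongr (k : ℕ) : EqOn (fun _ => f (h * (k + 1))) (fun s => f (h * ⌈s / h⌉₊))
      (uIoc (h * k) (h * (k + 1 : ℕ))) := by
    intro s hs
    push_cast at hs
    rw [uIoc_of_le (hle k)] at hs
    simp [natCeil_div_eq_of_mem_Ioc hh hs]
  have hsum := intervalIntegral.sum_integral_adjacent_intervals (μ := volume)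
    (f := fun s => f (h * ⌈s / h⌉₊)) (a := fun k : ℕ => h * k) (n := n)
    (fun k _ => (intervalIntegrable_const (c := f (h * (k + 1)))).congr (hcongr k))
  simp only [Nat.cast_zero, mul_zero] at hsum
  rw [← hsum, Finset.mul_sum]
  refine Finset.sum_congr rfl fun k _ => ?_
  rw [← intervalIntegral.integral_congr_ae (ae_of_all _ fun s hs => hcongr k hs)]
  simp only [intervalIntegral.integral_const, smul_eq_mul]
  push_cast
  ring

lemma tendsto_mul_ceil_div {s T : ℝ} (hs : 0 ≤ s) (hT : 0 < T) :
    Tendsto (fun n : ℕ => T / n * ⌈s / (T / n)⌉₊) atTop (𝓝 s) := by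
  have hup : Tendsto (fun n : ℕ => s + T / n) atTop (𝓝 s) := by
    simpa using (tendsto_const_div_atTop_nhds_zero_nat T).const_add s
  refine tendsto_of_tendsto_of_tendsto_of_le_of_le' tendsto_const_nhds hup ?_ ?_
  all_goals
    filter_upwards [eventually_gt_atTop 0] with n hn
    have hh : 0 < T / n := by positivity
  · have := Nat.le_ceil (s / (T / n))
    rw [div_le_iff₀ hh] at this
    linarith
  · have := (Nat.ceil_lt_add_one (a := s / (T / n)) (by positivity)).le
    calc T / n * ⌈s / (T / n)⌉₊ ≤ T / n * (s / (T / n) + 1) := by gcongr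
      _ = s + T / n := by rw [mul_add, mul_div_cancel₀ _ hh.ne', mul_one]

lemma mul_ceil_div_mem_Icc {s T : ℝ} {n : ℕ} (hn : 0 < n) (hT : 0 < T) (hs : s ≤ T) :
    T / n * ⌈s / (T / n)⌉₊ ∈ Icc 0 T := by
  refine ⟨by positivity, ?_⟩
  have hc : ⌈s / (T / n)⌉₊ ≤ n := by
    rw [Nat.ceil_le, div_le_iff₀ (by positivity)]
    field_simp
    exact hs
  calc T / n * ⌈s / (T / n)⌉₊ ≤ T / n * n := by gcongr
    _ = T := by field_simp

lemma sample_mem_Ioc {T : ℝ} (hT : 0 < T) {n k : ℕ} (hk : k < n) :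
    T / n * ((k : ℝ) + 1) ∈ Ioc 0 T := by
  have hn : 0 < n := by lia
  refine ⟨by positivity, ?_⟩
  calc T / n * ((k : ℝ) + 1) ≤ T / n * n := by gcongr; exact_mod_cast hk
    _ = T := by field_simp

/-- Right-endpoint Riemann sums of a bounded, almost everywhere continuous function converge. -/
lemma tendsto_riemann_sum {f : ℝ → ℝ} {T C : ℝ} (hT : 0 < T) (hC : ∀ s ∈ Icc 0 T, |f s| ≤ C)
    (hf : ∀ᵐ s, s ∈ Ioc 0 T → ContinuousWithinAt f (Icc 0 T) s) :
    Tendsto (fun n : ℕ => T / n * ∑ k ∈ Finset.range n, f (T / n * (k + 1))) atTop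
      (𝓝 (∫ s in (0 : ℝ)..T, f s)) := by
  have hlim : Tendsto (fun n : ℕ => ∫ s in (0 : ℝ)..T, f (T / n * ⌈s / (T / n)⌉₊)) atTop
      (𝓝 (∫ s in (0 : ℝ)..T, f s)) := by
    refine intervalIntegral.tendsto_integral_filter_of_dominated_convergence (fun _ => C) ?_ ?_
      intervalIntegrable_const ?_
    · refine Eventually.of_forall fun n => Measurable.aestronglyMeasurable ?_
      have hm : Measurable fun m : ℕ => f (T / n * m) := measurable_from_nat
      exact hm.comp (Nat.measurable_ceil.comp (measurable_id.div_const _))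
    · filter_upwards [eventually_gt_atTop 0] with n hn
      refine ae_of_all _ fun s hs => hC _ ?_
      rw [uIoc_of_le hT.le] at hs
      exact mul_ceil_div_mem_Icc hn hT hs.2
    · filter_upwards [hf] with s hfs hs
      rw [uIoc_of_le hT.le] at hs
      refine (hfs hs).tendsto.comp (tendsto_nhdsWithin_iff.2 ⟨tendsto_mul_ceil_div hs.1.le hT, ?_⟩)
      filter_upwards [eventually_gt_atTop 0] with n hn
      exact mul_ceil_div_mem_Icc hn hT hs.2
  refine hlim.congr' ?_
  filter_upwards [eventually_gt_atTop 0] with n hn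
  have hh : 0 < T / n := by positivity
  rw [mul_sum_eq_integral_comp_ceil f hh n]
  congr 1
  field_simp

/-- The response at time `s` of the Ornstein–Uhlenbeck process to an impulse at time `u`. -/
noncomputable def ouKernel (r u s : ℝ) : ℝ := if u ≤ s then Real.exp (-(r * (s - u))) else 0

lemma ouKernel_nonneg (r u s : ℝ) : 0 ≤ ouKernel r u s := by
  unfold ouKernel; split_ifs <;> positivity

lemma ouKernel_le_one {r : ℝ} (hr : 0 < r) (u s : ℝ) : ouKernel r u s ≤ 1 := by
  unfold ouKernel
  split_ifs with h
  · have : 0 ≤ r * (s - u) := mul_nonneg hr.le (sub_nonneg.2 h)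
    simpa using this
  · exact zero_le_one

lemma measurable_ouKernel (r s : ℝ) : Measurable fun u => ouKernel r u s :=
  Measurable.ite measurableSet_Iic (by fun_prop) measurable_const

lemma continuousAt_ouKernel (r : ℝ) {u s : ℝ} (h : s ≠ u) : ContinuousAt (ouKernel r u) s := by
  rcases lt_or_gt_of_ne h with h | h
  · refine (continuousAt_const (y := (0 : ℝ))).congr ?_
    filter_upwards [gt_mem_nhds h] with x hx
    simp [ouKernel, not_le.2 hx]
  · have hc : ContinuousAt (fun x => Real.exp (-(r * (x - u)))) s := by fun_prop
    refine hc.congr ?_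
    filter_upwards [lt_mem_nhds h] with x hx
    simp [ouKernel, hx.le]

lemma integral_ouKernel_mul (r : ℝ) (f : ℝ → ℝ) {u T : ℝ} (hu : u ∈ Ioc 0 T) :
    ∫ s in (0 : ℝ)..T, ouKernel r u s * f s = ∫ s in u..T, Real.exp (-(r * (s - u))) * f s := by
  rw [intervalIntegral.integral_of_le (hu.1.le.trans hu.2), intervalIntegral.integral_of_le hu.2,
    ← integral_Icc_eq_integral_Ioc (x := u)]
  have hind : (fun s => ouKernel r u s * f s) =
      (Ici u).indicator fun s => Real.exp (-(r * (s - u))) * f s := by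
    ext s
    by_cases h : u ≤ s <;> simp [ouKernel, h]
  rw [hind, setIntegral_indicator measurableSet_Ici]
  congr 2
  ext s
  simp only [mem_inter_iff, mem_Ioc, mem_Ici, mem_Icc]
  exact ⟨fun h => ⟨h.2, h.1.2⟩, fun h => ⟨⟨hu.1.trans_le h.1, h.2⟩, h.1⟩⟩

/-- The Brownian clock of the Ornstein–Uhlenbeck process. -/
noncomputable def ouClock (r t : ℝ) : ℝ := (Real.exp (2 * r * t) - 1) / (2 * r)

lemma ouClock_mono {r : ℝ} (hr : 0 < r) : Monotone (ouClock r) := by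
  intro s t h
  unfold ouClock
  gcongr

lemma ouClock_nonneg {r t : ℝ} (hr : 0 < r) (ht : 0 ≤ t) : 0 ≤ ouClock r t := by
  have h := ouClock_mono hr ht
  simpa [ouClock] using h

lemma integral_exp_eq_ouClock {r : ℝ} (hr : 0 < r) (m : ℝ) :
    ∫ u in (0 : ℝ)..m, Real.exp (2 * r * u) = ouClock r m := by
  rw [intervalIntegral.integral_comp_mul_left _ (by positivity : 2 * r ≠ 0), integral_exp]
  simp only [smul_eq_mul, ouClock, mul_zero, Real.exp_zero]
  ring

/-- The covariance of the Ornstein–Uhlenbeck process as a Gram kernel. -/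
lemma integral_ouKernel_mul_ouKernel {r s t T : ℝ} (hr : 0 < r) (hs : s ∈ Ioc 0 T)
    (ht : t ∈ Ioc 0 T) :
    ∫ u in (0 : ℝ)..T, ouKernel r u s * ouKernel r u t =
      Real.exp (-r * s) * Real.exp (-r * t) * min (ouClock r s) (ouClock r t) := by
  have hm : 0 < min s t := lt_min hs.1 ht.1
  rw [← (ouClock_mono hr).map_min, ← integral_exp_eq_ouClock hr,
    ← intervalIntegral.integral_const_mul, intervalIntegral.integral_of_le (hs.1.le.trans hs.2),
    intervalIntegral.integral_of_le hm.le]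
  have hind : (fun u => ouKernel r u s * ouKernel r u t) = (Iic (min s t)).indicator
      fun u => Real.exp (-r * s) * Real.exp (-r * t) * Real.exp (2 * r * u) := by
    ext u
    by_cases h : u ≤ min s t
    · have h' := le_min_iff.1 h
      rw [indicator_of_mem (by exact h), ouKernel, ouKernel, if_pos h'.1, if_pos h'.2,
        ← Real.exp_add, ← Real.exp_add, ← Real.exp_add]
      congr 1
      ring
    · rw [indicator_of_notMem (by exact h)]
      rw [le_min_iff, not_and_or] at h
      rcases h with h | h <;> simp [ouKernel, h]
  rw [hind, setIntegral_indicator measurableSet_Iic]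
  congr 2
  rw [Ioc_inter_Iic, min_eq_right ((min_le_left s t).trans hs.2)]

/-- The variance of `∑ k, b k * X (s k)` for an Ornstein–Uhlenbeck process `X`. -/
lemma integral_sq_sum_ouKernel {r T : ℝ} (hr : 0 < r) {n : ℕ} (s b : Fin n → ℝ)
    (hs : ∀ k, s k ∈ Ioc 0 T) :
    ∫ u in (0 : ℝ)..T, (∑ k, ouKernel r u (s k) * b k) ^ 2 =
      ∑ j, ∑ k, (b j * Real.exp (-r * s j)) * (b k * Real.exp (-r * s k)) *
        min (ouClock r (s j)) (ouClock r (s k)) := by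
  have hint (j k : Fin n) : IntervalIntegrable
      (fun u => b j * b k * (ouKernel r u (s j) * ouKernel r u (s k))) volume 0 T := by
    refine IntervalIntegrable.const_mul ?_ _
    refine (intervalIntegrable_const (c := (1 : ℝ))).mono_fun
      ((measurable_ouKernel r _).mul (measurable_ouKernel r _)).aestronglyMeasurable
      (ae_of_all _ fun u => ?_)
    simp only
    rw [norm_mul, Real.norm_of_nonneg (ouKernel_nonneg _ _ _),
      Real.norm_of_nonneg (ouKernel_nonneg _ _ _), norm_one]
    exact mul_le_one₀ (ouKernel_le_one hr _ _) (ouKernel_nonneg _ _ _) (ouKernel_le_one hr _ _)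
  have hint_sum (j : Fin n) : IntervalIntegrable
      (fun u => ∑ k, b j * b k * (ouKernel r u (s j) * ouKernel r u (s k))) volume 0 T := by
    simpa only [Finset.sum_fn] using IntervalIntegrable.sum Finset.univ fun k _ => hint j k
  have hexp : (fun u => (∑ k, ouKernel r u (s k) * b k) ^ 2) =
      fun u => ∑ j, ∑ k, b j * b k * (ouKernel r u (s j) * ouKernel r u (s k)) := by
    ext u
    rw [sq, Finset.sum_mul_sum]
    refine Finset.sum_congr rfl fun j _ => Finset.sum_congr rfl fun k _ => by ring
  rw [hexp, intervalIntegral.integral_finsetSum fun j _ => hint_sum j]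
  refine Finset.sum_congr rfl fun j _ => ?_
  rw [intervalIntegral.integral_finsetSum fun k _ => hint j k]
  refine Finset.sum_congr rfl fun k _ => ?_
  rw [intervalIntegral.integral_const_mul, integral_ouKernel_mul_ouKernel hr (hs j) (hs k)]
  ring

lemma IsStdBM.integral_exp_sum {Ω : Type*} [MeasurableSpace Ω] {P : Measure Ω} {W : ℝ → Ω → ℝ}
    (hW : IsStdBM P W) {n : ℕ} (t c : Fin n → ℝ) (ht : ∀ k, 0 ≤ t k) :
    ∫ ω, Complex.exp (Complex.I * (∑ k, c k * W (t k) ω : ℝ)) ∂P =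
      Complex.exp (-((∑ j, ∑ k, c j * c k * min (t j) (t k)).toNNReal : ℝ) / 2) := by
  have hm : Measurable fun ω => ∑ k, c k * W (t k) ω :=
    Finset.measurable_sum _ fun k _ => (hW.1 (t k)).const_mul (c k)
  have hchar := charFun_gaussianReal (μ := 0)
    (v := (∑ j, ∑ k, c j * c k * min (t j) (t k)).toNNReal) 1
  rw [← hW.2.2.2 n t c ht, charFun_apply_real, integral_map hm.aemeasurable
    (by fun_prop)] at hchar
  simpa [mul_comm Complex.I, neg_div] using hchar

lemma integral_exp_I_sum_mul_of_indepFun {Ω : Type*} [MeasurableSpace Ω] {P : Measure Ω}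
    [IsProbabilityMeasure P] {n : ℕ} {A B : Ω → Fin n → ℝ} (hA : Measurable A) (hB : Measurable B)
    (h : IndepFun A B P) :
    ∫ ω, Complex.exp (Complex.I * (∑ k, B ω k * A ω k : ℝ)) ∂P =
      ∫ ω, ∫ ω', Complex.exp (Complex.I * (∑ k, B ω k * A ω' k : ℝ)) ∂P ∂P := by
  let F : (Fin n → ℝ) × (Fin n → ℝ) → ℂ := fun p =>
    Complex.exp (Complex.I * (∑ k, p.2 k * p.1 k : ℝ))
  have hF : Continuous F := by fun_prop
  have := Measure.isProbabilityMeasure_map (μ := P) hA.aemeasurable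
  have := Measure.isProbabilityMeasure_map (μ := P) hB.aemeasurable
  have hint : Integrable F ((P.map A).prod (P.map B)) := by
    refine Integrable.of_bound hF.aestronglyMeasurable 1 (ae_of_all _ fun p => ?_)
    simp only [F]
    rw [mul_comm, Complex.norm_exp_ofReal_mul_I]
  have hprod := (indepFun_iff_map_prod_eq_prod_map_map hA.aemeasurable hB.aemeasurable).1 h
  calc ∫ ω, Complex.exp (Complex.I * (∑ k, B ω k * A ω k : ℝ)) ∂P
      = ∫ p, F p ∂(P.map fun ω => (A ω, B ω)) := by
        rw [integral_map (hA.prodMk hB).aemeasurable hF.aestronglyMeasurable]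
    _ = ∫ b, ∫ a, F (a, b) ∂(P.map A) ∂(P.map B) := by
        rw [hprod, integral_prod_symm F hint]
    _ = ∫ ω, ∫ a, F (a, B ω) ∂(P.map A) ∂P := by
        exact integral_map hB.aemeasurable hint.swap.integral_prod_left.aestronglyMeasurable
    _ = _ := by
        refine integral_congr_ae (ae_of_all _ fun ω => ?_)
        simp only
        rw [integral_map hA.aemeasurable (by fun_prop)]

/-- The characteristic-function identity for weighted sums over finitely many sample times. -/
lemma integral_exp_sum_ou_mul_ou {Ω : Type*} [MeasurableSpace Ω] {P : Measure Ω}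
    [IsProbabilityMeasure P] {r : ℝ} (hr : 0 < r) {W₁ W₂ : ℝ → Ω → ℝ}
    (hW₁ : IsStdBM P W₁) (hW₂ : IsStdBM P W₂)
    (hindep : IndepFun (fun ω => fun t => W₁ t ω) (fun ω => fun t => W₂ t ω) P)
    {X₁ X₂ : ℝ → Ω → ℝ}
    (hX₁ : ∀ t ω, X₁ t ω = Real.exp (-r * t) * W₁ (ouClock r t) ω)
    (hX₂ : ∀ t ω, X₂ t ω = Real.exp (-r * t) * W₂ (ouClock r t) ω)
    {T : ℝ} (a : ℝ) {n : ℕ} (s : Fin n → ℝ) (hs : ∀ k, s k ∈ Ioc 0 T) :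
    ∫ ω, Complex.exp (Complex.I * (a * ∑ k, X₁ (s k) ω * X₂ (s k) ω : ℝ)) ∂P =
      ∫ ω, Complex.exp ((-(a ^ 2 / 2) *
        ∫ u in (0 : ℝ)..T, (∑ k, ouKernel r u (s k) * X₂ (s k) ω) ^ 2 : ℝ)) ∂P := by
  let φ : (ℝ → ℝ) → Fin n → ℝ := fun w k => w (ouClock r (s k))
  let ψ : (ℝ → ℝ) → Fin n → ℝ := fun w k =>
    a * (Real.exp (-r * s k) * w (ouClock r (s k))) * Real.exp (-r * s k)
  have hφ : Measurable φ := by fun_prop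
  have hψ : Measurable ψ := by fun_prop
  have hA := hφ.comp (measurable_pi_lambda _ hW₁.1)
  have hB := hψ.comp (measurable_pi_lambda _ hW₂.1)
  have key := integral_exp_I_sum_mul_of_indepFun hA hB (hindep.comp hφ hψ)
  calc ∫ ω, Complex.exp (Complex.I * (a * ∑ k, X₁ (s k) ω * X₂ (s k) ω : ℝ)) ∂P
      = ∫ ω, Complex.exp (Complex.I * (∑ k, ψ (fun t => W₂ t ω) k * φ (fun t => W₁ t ω) k : ℝ))
          ∂P := by
        refine integral_congr_ae (ae_of_all _ fun ω => ?_)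
        simp only [hX₁, hX₂, φ, ψ, Finset.mul_sum]
        congr 4
        ext k
        ring
    _ = _ := key
    _ = _ := by
        refine integral_congr_ae (ae_of_all _ fun ω => ?_)
        simp only [Function.comp_apply, φ]
        rw [hW₁.integral_exp_sum _ _ fun k => ouClock_nonneg hr (hs k).1.le]
        have hgram := integral_sq_sum_ouKernel hr s (fun k => a * X₂ (s k) ω) hs
        have hv : ∑ j, ∑ k, ψ (fun t => W₂ t ω) j * ψ (fun t => W₂ t ω) k *
            min (ouClock r (s j)) (ouClock r (s k)) =
            a ^ 2 * ∫ u in (0 : ℝ)..T, (∑ k, ouKernel r u (s k) * X₂ (s k) ω) ^ 2 := by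
          simp only [ψ, ← hX₂]
          rw [← hgram, ← intervalIntegral.integral_const_mul]
          congr 1
          ext u
          rw [← mul_pow, Finset.mul_sum]
          congr 2
          ext k
          ring
        have hnn : 0 ≤ ∑ j, ∑ k, ψ (fun t => W₂ t ω) j * ψ (fun t => W₂ t ω) k *
            min (ouClock r (s j)) (ouClock r (s k)) := by
          rw [hv]
          rcases isEmpty_or_nonempty (Fin n) with _ | ⟨⟨k⟩⟩
          · simp
          · exact mul_nonneg (sq_nonneg _) (intervalIntegral.integral_nonneg
              ((hs k).1.le.trans (hs k).2) fun _ _ => sq_nonneg _)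
        rw [Real.coe_toNNReal _ hnn, hv]
        congr 1
        push_cast
        ring

/-- Convergence of the discretized quadratic functional along a continuous path. -/
lemma tendsto_integral_sq_riemann_sum_ouKernel {r T : ℝ} (hr : 0 < r) (hT : 0 < T) {x : ℝ → ℝ}
    (hx : ContinuousOn x (Icc 0 T)) :
    Tendsto (fun n : ℕ => ∫ u in (0 : ℝ)..T, (T / n * ∑ k ∈ Finset.range n,
        ouKernel r u (T / n * (k + 1)) * x (T / n * (k + 1))) ^ 2) atTop
      (𝓝 (∫ u in (0 : ℝ)..T, (∫ s in u..T, Real.exp (-(r * (s - u))) * x s) ^ 2)) := by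
  obtain ⟨C, hC⟩ := isCompact_Icc.exists_bound_of_continuousOn hx
  have hbound (u s : ℝ) (hs : s ∈ Icc 0 T) : |ouKernel r u s * x s| ≤ C := by
    rw [abs_mul, abs_of_nonneg (ouKernel_nonneg _ _ _)]
    calc ouKernel r u s * |x s| ≤ 1 * |x s| := by gcongr; exact ouKernel_le_one hr u s
      _ ≤ C := by simpa using hC s hs
  refine intervalIntegral.tendsto_integral_filter_of_dominated_convergence (fun _ => (T * C) ^ 2)
    (Eventually.of_forall fun n => ?_) ?_ intervalIntegrable_const (ae_of_all _ fun u hu => ?_)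
  · exact (((Finset.measurable_sum _ fun k _ =>
      (measurable_ouKernel r _).mul_const _).const_mul _).pow_const _).aestronglyMeasurable
  · filter_upwards [eventually_gt_atTop 0] with n hn
    refine ae_of_all _ fun u _ => ?_
    rw [norm_pow]
    gcongr
    rw [norm_mul, Real.norm_of_nonneg (by positivity)]
    have hsum : ‖∑ k ∈ Finset.range n, ouKernel r u (T / n * (k + 1)) * x (T / n * (k + 1))‖
        ≤ n * C := by
      refine (norm_sum_le_of_le _ fun k hk => hbound u _ ?_).trans_eq (b := ∑ k ∈ Finset.range n, C)
        (by simp)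
      exact Ioc_subset_Icc_self (sample_mem_Ioc hT (Finset.mem_range.1 hk))
    calc T / n * _ ≤ T / n * (n * C) := by gcongr
      _ = T * C := by field_simp
  · rw [uIoc_of_le hT.le] at hu
    rw [← integral_ouKernel_mul r x hu]
    refine (tendsto_riemann_sum hT (hbound u) ?_).pow 2
    filter_upwards [compl_mem_ae_iff.2 (measure_singleton u)] with s hs hsT
    exact (continuousAt_ouKernel r hs).continuousWithinAt.mul (hx s (Ioc_subset_Icc_self hsT))

lemma IsStdBM.continuousOn_ou {Ω : Type*} [MeasurableSpace Ω] {P : Measure Ω} {W : ℝ → Ω → ℝ}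
    (hW : IsStdBM P W) {r : ℝ} (hr : 0 < r) (ω : Ω) :
    ContinuousOn (fun t => Real.exp (-r * t) * W (ouClock r t) ω) (Ici 0) := by
  refine ContinuousOn.mul (by fun_prop) ((hW.2.1 ω).comp ?_ fun t ht => ouClock_nonneg hr ht)
  unfold ouClock
  fun_prop

end

theorem stmt_17 {Ω : Type*} [MeasurableSpace Ω] (P : Measure Ω) [IsProbabilityMeasure P]
    (r : ℝ) (hr : 0 < r) (W₁ W₂ : ℝ → Ω → ℝ) (hW₁ : IsStdBM P W₁) (hW₂ : IsStdBM P W₂)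
    (hindep : IndepFun (fun ω => fun t => W₁ t ω) (fun ω => fun t => W₂ t ω) P)
    (X₁ X₂ : ℝ → Ω → ℝ)
    (hX₁ : ∀ t ω, X₁ t ω = Real.exp (-r * t) * W₁ ((Real.exp (2 * r * t) - 1) / (2 * r)) ω)
    (hX₂ : ∀ t ω, X₂ t ω = Real.exp (-r * t) * W₂ ((Real.exp (2 * r * t) - 1) / (2 * r)) ω)
    (T θ : ℝ) (hT : 0 < T) :
    ∫ ω, Complex.exp (Complex.I * (θ : ℂ) / (Real.sqrt T : ℂ) *
        ((∫ s in (0:ℝ)..T, X₁ s ω * X₂ s ω : ℝ) : ℂ)) ∂P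
      = ((∫ ω, Real.exp (-(θ ^ 2 / (2 * T)) *
          ∫ u in (0:ℝ)..T,
            (∫ s in u..T, Real.exp (-(r * (s - u))) * X₂ s ω) ^ 2) ∂P : ℝ) : ℂ) := by
  have hX₁' (t ω) : X₁ t ω = Real.exp (-r * t) * W₁ (ouClock r t) ω := hX₁ t ω
  have hX₂' (t ω) : X₂ t ω = Real.exp (-r * t) * W₂ (ouClock r t) ω := hX₂ t ω
  have hc₁ (ω) : ContinuousOn (fun t => X₁ t ω) (Set.Icc 0 T) := by
    simp only [hX₁']
    exact (hW₁.continuousOn_ou hr ω).mono Set.Icc_subset_Ici_self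
  have hc₂ (ω) : ContinuousOn (fun t => X₂ t ω) (Set.Icc 0 T) := by
    simp only [hX₂']
    exact (hW₂.continuousOn_ou hr ω).mono Set.Icc_subset_Ici_self
  have hm₁ (t) : Measurable (X₁ t) := by
    rw [show X₁ t = _ from funext (hX₁' t)]
    exact (hW₁.1 _).const_mul _
  have hm₂ (t) : Measurable (X₂ t) := by
    rw [show X₂ t = _ from funext (hX₂' t)]
    exact (hW₂.1 _).const_mul _
  let a : ℝ := θ / Real.sqrt T
  have ha : a ^ 2 / 2 = θ ^ 2 / (2 * T) := by
    simp only [a, div_pow, Real.sq_sqrt hT.le]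
    field_simp
  let S : ℕ → Ω → ℝ := fun n ω =>
    T / n * ∑ k ∈ Finset.range n, X₁ (T / n * (k + 1)) ω * X₂ (T / n * (k + 1)) ω
  let Q : ℕ → Ω → ℝ := fun n ω => ∫ u in (0 : ℝ)..T, (T / n * ∑ k ∈ Finset.range n,
    ouKernel r u (T / n * (k + 1)) * X₂ (T / n * (k + 1)) ω) ^ 2
  have hQsum (n ω) : Q n ω = (T / n) ^ 2 * ∫ u in (0 : ℝ)..T, (∑ k : Fin n,
      ouKernel r u (T / n * ((k : ℕ) + 1)) * X₂ (T / n * ((k : ℕ) + 1)) ω) ^ 2 := by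
    simp only [Q, mul_pow, intervalIntegral.integral_const_mul, Finset.sum_range]
  have hSQ (n) : ∫ ω, Complex.exp (Complex.I * (a * S n ω : ℝ)) ∂P =
      ∫ ω, Complex.exp ((-(a ^ 2 / 2) * Q n ω : ℝ)) ∂P := by
    have key := integral_exp_sum_ou_mul_ou hr hW₁ hW₂ hindep hX₁' hX₂' (T := T) (a * (T / n))
      (fun k : Fin n => T / n * ((k : ℕ) + 1)) fun k => sample_mem_Ioc hT k.2
    calc _ = _ := ?_
      _ = _ := key
      _ = _ := ?_
    · simp only [S, Finset.sum_range, mul_assoc]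
    · simp only [hQsum]
      refine integral_congr_ae (ae_of_all _ fun ω => ?_)
      simp only
      congr 2
      ring
  have hQm (n) : Measurable (Q n) := by
    have hQn : Q n = fun ω => (T / n) ^ 2 * _ := funext fun ω => (hQsum n ω).trans (by
      rw [integral_sq_sum_ouKernel hr _ _ fun k : Fin n => sample_mem_Ioc hT k.2])
    rw [hQn]
    fun_prop
  have hlimS : Tendsto (fun n => ∫ ω, Complex.exp (Complex.I * (a * S n ω : ℝ)) ∂P) atTop
      (nhds (∫ ω, Complex.exp (Complex.I * (a * ∫ s in (0 : ℝ)..T, X₁ s ω * X₂ s ω : ℝ)) ∂P)) := by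
    refine tendsto_integral_of_dominated_convergence (fun _ => 1) (fun n => ?_)
      (integrable_const _) (fun n => ae_of_all _ fun ω => ?_) (ae_of_all _ fun ω => ?_)
    · have hSm : Measurable (S n) := by fun_prop
      exact Measurable.aestronglyMeasurable (by fun_prop)
    · rw [mul_comm, Complex.norm_exp_ofReal_mul_I]
    · have hc := (hc₁ ω).mul (hc₂ ω)
      obtain ⟨C, hC⟩ := isCompact_Icc.exists_bound_of_continuousOn hc
      have hS : Tendsto (fun n => S n ω) atTop (nhds (∫ s in (0 : ℝ)..T, X₁ s ω * X₂ s ω)) :=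
        tendsto_riemann_sum hT hC (ae_of_all _ fun s hs => hc s (Set.Ioc_subset_Icc_self hs))
      have hcont : Continuous fun y : ℝ => Complex.exp (Complex.I * (a * y : ℝ)) := by fun_prop
      exact (hcont.tendsto _).comp hS
  have hlimQ : Tendsto (fun n => ∫ ω, Complex.exp ((-(a ^ 2 / 2) * Q n ω : ℝ)) ∂P) atTop
      (nhds (∫ ω, Complex.exp ((-(a ^ 2 / 2) * ∫ u in (0 : ℝ)..T,
        (∫ s in u..T, Real.exp (-(r * (s - u))) * X₂ s ω) ^ 2 : ℝ)) ∂P)) := by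
    refine tendsto_integral_of_dominated_convergence (fun _ => 1) (fun n => ?_)
      (integrable_const _) (fun n => ae_of_all _ fun ω => ?_) (ae_of_all _ fun ω => ?_)
    · have := hQm n
      exact Measurable.aestronglyMeasurable (by fun_prop)
    · rw [Complex.norm_exp_ofReal, Real.exp_le_one_iff]
      have hQ : 0 ≤ Q n ω := intervalIntegral.integral_nonneg hT.le fun _ _ => sq_nonneg _
      have : 0 ≤ a ^ 2 / 2 * Q n ω := by positivity
      linarith
    · have hcont : Continuous fun y : ℝ => Complex.exp ((-(a ^ 2 / 2) * y : ℝ)) := by fun_prop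
      have hQ : Tendsto (fun n => Q n ω) atTop (nhds (∫ u in (0 : ℝ)..T,
          (∫ s in u..T, Real.exp (-(r * (s - u))) * X₂ s ω) ^ 2)) :=
        tendsto_integral_sq_riemann_sum_ouKernel (x := fun t => X₂ t ω) hr hT (hc₂ ω)
      exact (hcont.tendsto _).comp hQ
  simp only [hSQ] at hlimS
  have heq := tendsto_nhds_unique hlimS hlimQ
  rw [ha] at heq
  rw [← integral_complex_ofReal]
  simp only [Complex.ofReal_exp]
  rw [← heq]
  refine integral_congr_ae (ae_of_all _ fun ω => ?_)
  simp only [a]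
  congr 1
  push_cast
  ring
end
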